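/- arXiv:2409.08474 — 3 statements merged into one kernel-verified Lean document; each statement's English description precedes it below -/
import Mathlib

section
/- In the two-task Gaussian factor model with μ_j ≠ 0, the Bayes posterior Π(a_i, a_j) = J_1(a_i, a_j) / (J_1(a_i, a_j) + J_{−1}(a_i, a_j)) satisfies: the function a_j ↦ Π(a_i, a_j) is constant for every fixed a_i if and only if p = 1/2. Equivalently, whenever p ≠ 1/2 the optimal classifier for task i has a genuine (non-constant) dependence on the task-specific factor a_j of task j. -/
open Real

/-- The Gaussian density `φ(a; μ, σ)`. -/
noncomputable def gaussPdf (a μ σ : ℝ) : ℝ :=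
  (1 / (σ * Real.sqrt (2 * Real.pi))) * Real.exp (-(a - μ) ^ 2 / (2 * σ ^ 2))

/-- The joint weight `J_y(a_i, a_j)` of the two-task Gaussian factor model. -/
noncomputable def jointWeight (μi μj σi σj p : ℝ) (y : ℝ) (ai aj : ℝ) : ℝ :=
  gaussPdf ai (y * μi) σi *
    (p * gaussPdf aj (y * μj) σj + (1 - p) * gaussPdf aj (-(y * μj)) σj)

/-- The Bayes posterior `Π(a_i, a_j) = J_1 / (J_1 + J_{-1})`. -/
noncomputable def bayesPosterior (μi μj σi σj p : ℝ) (ai aj : ℝ) : ℝ :=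
  jointWeight μi μj σi σj p 1 ai aj /
    (jointWeight μi μj σi σj p 1 ai aj + jointWeight μi μj σi σj p (-1) ai aj)

theorem gaussPdf_pos (a μ σ : ℝ) (h : 0 < σ) : 0 < gaussPdf a μ σ := by
  unfold gaussPdf
  have := Real.pi_pos
  positivity

theorem gaussPdf_lt (μ σ : ℝ) (h : 0 < σ) (hμ : μ ≠ 0) : gaussPdf μ (-μ) σ < gaussPdf μ μ σ := by
  unfold gaussPdf
  have := Real.pi_pos
  apply mul_lt_mul_of_pos_left _ (by positivity)
  apply Real.exp_lt_exp.mpr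
  apply div_lt_div_of_pos_right _ (by positivity)
  have : 0 < μ ^ 2 := by positivity
  nlinarith

theorem gaussPdf_zero_neg (μ σ : ℝ) : gaussPdf 0 (-μ) σ = gaussPdf 0 μ σ := by
  unfold gaussPdf
  simp

/-- In the two-task Gaussian factor model with `μ_j ≠ 0`, the function
`a_j ↦ Π(a_i, a_j)` is constant for every fixed `a_i` if and only if `p = 1/2`:
whenever `p ≠ 1/2` the optimal classifier for task `i` depends non-trivially on the
task-specific factor `a_j` of task `j`. -/
theorem bayes_posterior_const_iff (μi μj σi σj p : ℝ) (hσi : 0 < σi) (hσj : 0 < σj)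
    (hp : p ∈ Set.Ioo (0 : ℝ) 1) (hμj : μj ≠ 0) :
    (∀ ai aj aj' : ℝ,
        bayesPosterior μi μj σi σj p ai aj = bayesPosterior μi μj σi σj p ai aj') ↔
      p = 1 / 2 := by
  obtain ⟨hp0, hp1⟩ := hp
  constructor
  · intro h
    have h1 := h 0 μj 0
    simp only [bayesPosterior, jointWeight, one_mul, neg_mul, neg_neg, gaussPdf_zero_neg] at h1
    have hG := gaussPdf_pos 0 μi σi hσi
    have hA := gaussPdf_pos μj μj σj hσj
    have hB := gaussPdf_pos μj (-μj) σj hσj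
    have hC := gaussPdf_pos 0 μj σj hσj
    have hAB := gaussPdf_lt μj σj hσj hμj
    generalize gaussPdf 0 μi σi = G at *
    generalize gaussPdf μj μj σj = A at *
    generalize gaussPdf μj (-μj) σj = B at *
    generalize gaussPdf 0 μj σj = C at *
    have e1 : G * (p * A + (1 - p) * B) + G * (p * B + (1 - p) * A) = G * (A + B) := by ring
    have e2 : G * (p * C + (1 - p) * C) + G * (p * C + (1 - p) * C) = G * (2 * C) := by ring
    have e3 : G * (p * C + (1 - p) * C) = G * C := by ring
    rw [e1, e2, e3, div_eq_div_iff (by positivity) (by positivity)] at h1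
    have h2 : (G ^ 2 * C * (A - B)) * (2 * p - 1) = 0 := by linear_combination h1
    have hne : G ^ 2 * C * (A - B) ≠ 0 := by
      have : 0 < A - B := sub_pos.mpr hAB
      positivity
    have h3 := (mul_eq_zero.mp h2).resolve_left hne
    linarith
  · intro hp ai
    have key : ∀ aj, bayesPosterior μi μj σi σj p ai aj =
        gaussPdf ai μi σi / (gaussPdf ai μi σi + gaussPdf ai (-μi) σi) := by
      intro aj
      simp only [bayesPosterior, jointWeight, one_mul, neg_mul, neg_neg]
      have hG := gaussPdf_pos ai μi σi hσi
      have hH := gaussPdf_pos ai (-μi) σi hσi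
      have hA := gaussPdf_pos aj μj σj hσj
      have hB := gaussPdf_pos aj (-μj) σj hσj
      generalize gaussPdf ai μi σi = G at *
      generalize gaussPdf ai (-μi) σi = H at *
      generalize gaussPdf aj μj σj = A at *
      generalize gaussPdf aj (-μj) σj = B at *
      have hq : 1 - p = p := by linarith
      rw [hq, add_comm (p * B) (p * A), ← add_mul]
      exact mul_div_mul_right _ _ (by positivity)
    intro aj aj'
    rw [key, key]
end

section
/- Fix p ∈ (0,1) and u ∈ ℝ, and define G(v) = (p·exp(u+v) + (1−p)·exp(u−v)) / (p·exp(u+v) + (1−p)·exp(u−v) + p·exp(−(u+v)) + (1−p)·exp(−(u−v))). Then G is differentiable at v = 0 and G′(0) = 2(2p−1)/(exp(u) + exp(−u))². In particular G′(0) ≠ 0 if and only if p ≠ 1/2. -/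
open Real

/-- Fix `p ∈ (0,1)` and `u ∈ ℝ`, and define
`G(v) = (p e^{u+v} + (1−p) e^{u−v}) / (p e^{u+v} + (1−p) e^{u−v} + p e^{−(u+v)} + (1−p) e^{−(u−v)})`.
Then `G` is differentiable at `v = 0` with `G′(0) = 2(2p−1)/(e^u + e^{−u})²`, and
`G′(0) ≠ 0` if and only if `p ≠ 1/2`. -/
theorem posterior_deriv_at_zero (p u : ℝ) (hp : p ∈ Set.Ioo (0 : ℝ) 1) :
    HasDerivAt
      (fun v : ℝ =>
        (p * Real.exp (u + v) + (1 - p) * Real.exp (u - v)) /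
          (p * Real.exp (u + v) + (1 - p) * Real.exp (u - v) +
            p * Real.exp (-(u + v)) + (1 - p) * Real.exp (-(u - v))))
      (2 * (2 * p - 1) / (Real.exp u + Real.exp (-u)) ^ 2) 0 ∧
    (2 * (2 * p - 1) / (Real.exp u + Real.exp (-u)) ^ 2 ≠ 0 ↔ p ≠ 1 / 2) := by
  have hE : Real.exp u * Real.exp (-u) = 1 := by rw [← Real.exp_add]; simp
  have hpos : 0 < Real.exp u + Real.exp (-u) := by positivity
  constructor
  · have ha : HasDerivAt (fun v : ℝ => u + v) 1 0 := (hasDerivAt_id (0 : ℝ)).const_add u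
    have hs : HasDerivAt (fun v : ℝ => u - v) (-1) 0 := (hasDerivAt_id (0 : ℝ)).const_sub u
    have hN := (ha.exp.const_mul p).add (hs.exp.const_mul (1 - p))
    have hD := (hN.add (ha.neg.exp.const_mul p)).add (hs.neg.exp.const_mul (1 - p))
    have hval : p * Real.exp (u + 0) + (1 - p) * Real.exp (u - 0) +
        p * Real.exp (-(u + 0)) + (1 - p) * Real.exp (-(u - 0))
        = Real.exp u + Real.exp (-u) := by
      rw [add_zero, sub_zero]; ring
    have h := hN.div hD (by
      change p * Real.exp (u + 0) + (1 - p) * Real.exp (u - 0) +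
        p * Real.exp (-(u + 0)) + (1 - p) * Real.exp (-(u - 0)) ≠ 0
      rw [hval]; exact hpos.ne')
    refine h.congr_deriv ?_
    simp only [Pi.add_apply, Pi.neg_apply]
    rw [hval, add_zero, sub_zero]
    congr 1
    linear_combination (2 * (2 * p - 1)) * hE
  · have h2 : (Real.exp u + Real.exp (-u)) ^ 2 ≠ 0 := by positivity
    rw [not_iff_not, div_eq_zero_iff]
    constructor
    · rintro (h | h)
      · linarith
      · exact absurd h h2
    · intro h
      left
      rw [h]; norm_num
end

section
/- For every natural number N ≥ 1 and every ε ∈ (0,1], the binomial inverse moment satisfies ∑_{k=1}^{N} (N choose k) · ε^k · (1−ε)^{N−k} · (1/k) ≤ 2 / ((N+1)·ε). -/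
/-- For every natural number `N ≥ 1` and every `ε ∈ (0,1]`,
`∑_{k=1}^{N} C(N,k) ε^k (1−ε)^{N−k} (1/k) ≤ 2 / ((N+1) ε)`. -/
theorem binomial_inverse_moment_bound (N : ℕ) (hN : 1 ≤ N) (ε : ℝ)
    (hε : ε ∈ Set.Ioc (0 : ℝ) 1) :
    ∑ k ∈ Finset.Icc 1 N,
        (N.choose k : ℝ) * ε ^ k * (1 - ε) ^ (N - k) * (1 / (k : ℝ)) ≤
      2 / ((N + 1 : ℝ) * ε) := by
  obtain ⟨h0, h1⟩ := hε
  have h1' : 0 ≤ 1 - ε := by linarith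
  rw [le_div_iff₀ (by positivity), Finset.sum_mul]
  have hb := add_pow ε (1 - ε) (N + 1)
  rw [add_sub_cancel, one_pow, Finset.sum_range_succ'] at hb
  have hz : 0 ≤ ε ^ 0 * (1 - ε) ^ (N + 1 - 0) * ((N + 1).choose 0 : ℝ) := by positivity
  have hsub : Finset.Icc 1 N ⊆ Finset.range (N + 1) := by
    intro k hk
    simp only [Finset.mem_Icc, Finset.mem_range] at *
    omega
  have hs := Finset.sum_le_sum_of_subset_of_nonneg hsub
    (f := fun k => ε ^ (k + 1) * (1 - ε) ^ (N + 1 - (k + 1)) * ((N + 1).choose (k + 1) : ℝ))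
    (fun i _ _ => by positivity)
  have ht : ∀ k ∈ Finset.Icc 1 N,
      (N.choose k : ℝ) * ε ^ k * (1 - ε) ^ (N - k) * (1 / (k : ℝ)) * ((N + 1 : ℝ) * ε) ≤
      2 * (ε ^ (k + 1) * (1 - ε) ^ (N + 1 - (k + 1)) * ((N + 1).choose (k + 1) : ℝ)) := by
    intro k hk
    have hk1 : (1 : ℝ) ≤ k := by exact_mod_cast (Finset.mem_Icc.mp hk).1
    have hc : ((N : ℝ) + 1) * N.choose k = (N + 1).choose (k + 1) * ((k : ℝ) + 1) := by
      exact_mod_cast Nat.add_one_mul_choose_eq N k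
    have hr : ((k : ℝ) + 1) * (1 / (k : ℝ)) ≤ 2 := by
      rw [mul_one_div, div_le_iff₀ (by linarith)]
      linarith
    rw [Nat.add_sub_add_right]
    calc _ = (((N : ℝ) + 1) * N.choose k) * (ε ^ (k + 1) * (1 - ε) ^ (N - k)) * (1 / (k : ℝ)) := by
          ring
      _ = (((k : ℝ) + 1) * (1 / (k : ℝ))) *
          (ε ^ (k + 1) * (1 - ε) ^ (N - k) * ((N + 1).choose (k + 1) : ℝ)) := by
          rw [hc]; ring
      _ ≤ _ := mul_le_mul_of_nonneg_right hr (by positivity)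
  have hf := Finset.sum_le_sum ht
  rw [← Finset.mul_sum] at hf
  linarith
end
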